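/- Let p ∈ (0,∞) and n ≥ 1. Define φ_{Δₙ} : ℝⁿ → ℝ ∪ {+∞} by φ_{Δₙ}(x) := x₁ + … + xₙ if x ∈ [−1,∞)ⁿ and +∞ otherwise. Then M_p(φ_{Δₙ}) = ( e^{1+1/p} · p^{1/p} · Γ(1 + 1/p) )ⁿ, where Γ is the Gamma function. -/

import Mathlib

open MeasureTheory Real Filter
open scoped ENNReal RealInnerProductSpace Classical

noncomputable section

abbrev Euc (n : ℕ) : Type := EuclideanSpace ℝ (Fin n)

/-- `e^t` as an extended nonnegative real, for `t : EReal` (`e^{-∞}=0`, `e^{+∞}=∞`). -/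
def erealExp (t : EReal) : ℝ≥0∞ :=
  if t = ⊥ then 0 else if t = ⊤ then ⊤ else ENNReal.ofReal (Real.exp t.toReal)

/-- The volume `V(f) = ∫ e^{-f}` of `f : ℝⁿ → ℝ ∪ {+∞}`, as an extended nonnegative real. -/
def VolE {n : ℕ} (f : Euc n → EReal) : ℝ≥0∞ := ∫⁻ x, erealExp (-(f x))

/-- The volume `V(f) = ∫ e^{-f}` as a real number. -/
def Vol {n : ℕ} (f : Euc n → EReal) : ℝ := (VolE f).toReal

/-- `∫ e^{p⟨x,y⟩ - (p+1) f(x)} dx`. -/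
def LpIntE {n : ℕ} (p : ℝ) (f : Euc n → EReal) (y : Euc n) : ℝ≥0∞ :=
  ∫⁻ x, erealExp (((p * ⟪x, y⟫ : ℝ) : EReal) - ((p + 1 : ℝ) : EReal) * f x)

/-- The `L^p`-Legendre transform
`f^{*,p}(y) = (1/p) log ( ∫ e^{p⟨x,y⟩ - (p+1) f(x)} dx / V(f) )`,
with value `+∞` when the integral diverges. -/
def LpStar {n : ℕ} (p : ℝ) (f : Euc n → EReal) (y : Euc n) : EReal :=
  if LpIntE p f y = ⊤ then ⊤
  else (((1 / p) * Real.log ((LpIntE p f y).toReal / Vol f) : ℝ) : EReal)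

/-- The `L^p`-Mahler integral `M_p(f) = V(f) · V(f^{*,p})`, as an extended nonnegative real. -/
def MpE {n : ℕ} (p : ℝ) (f : Euc n → EReal) : ℝ≥0∞ := VolE f * VolE (LpStar p f)

/-- The translate `(T_a f)(x) = f(x + a)`. -/
def Transl {n : ℕ} (a : Euc n) (f : Euc n → EReal) : Euc n → EReal := fun x => f (x + a)

/-- Convexity of an `ℝ ∪ {+∞}`-valued function. -/
def ConvexE {n : ℕ} (φ : Euc n → EReal) : Prop :=
  ∀ x y : Euc n, ∀ l : ℝ, 0 ≤ l → l ≤ 1 →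
    φ ((1 - l) • x + l • y) ≤ ((1 - l : ℝ) : EReal) * φ x + ((l : ℝ) : EReal) * φ y

/-- The class `Cvx(ℝⁿ)`: convex, lower semicontinuous functions `ℝⁿ → ℝ ∪ {+∞}`,
not identically `+∞`, with `0 < V(φ) < ∞`. -/
structure InCvx {n : ℕ} (φ : Euc n → EReal) : Prop where
  noBot : ∀ x, φ x ≠ ⊥
  convex : ConvexE φ
  lsc : LowerSemicontinuous φ
  proper : ∃ x, φ x ≠ ⊤
  volPos : 0 < VolE φ
  volFin : VolE φ < ⊤

/-- The barycenter `b(g) = ∫ x e^{-g(x)} dx / V(g)`. -/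
def bary {n : ℕ} (g : Euc n → EReal) : Euc n :=
  (Vol g)⁻¹ • ∫ x, (erealExp (-(g x))).toReal • x

/-- The classical Legendre transform `f^*(y) = sup_x (⟨x,y⟩ - f(x))`. -/
def Lstar {n : ℕ} (f : Euc n → EReal) (y : Euc n) : EReal :=
  ⨆ x : Euc n, (((⟪x, y⟫ : ℝ) : EReal) - f x)



/-- The functional simplex `φ_{Δₙ}(x) = x₁ + ⋯ + xₙ` on `[-1,∞)ⁿ`, `+∞` otherwise. -/
def funcSimplex (n : ℕ) : Euc n → EReal :=
  fun x => if ∀ i, (-1 : ℝ) ≤ x i then ((∑ i, x i : ℝ) : EReal) else ⊤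

theorem lintegral_pi_prod : ∀ (n : ℕ) (f : Fin n → ℝ → ℝ≥0∞), (∀ i, Measurable (f i)) →
    ∫⁻ x : Fin n → ℝ, ∏ i, f i (x i) = ∏ i, ∫⁻ t, f i t := by
  intro n
  induction n with
  | zero => intro f hf; simp [volume_pi]
  | succ n ih =>
    intro f hf
    have e := (volume_preserving_piFinSuccAbove (fun _ : Fin (n + 1) => ℝ) 0).symm
    rw [← e.lintegral_comp_emb (MeasurableEquiv.measurableEmbedding _)]
    simp only [Fin.prod_univ_succ]
    rw [← ih (fun i => f i.succ) (fun i => hf _)]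
    rw [← lintegral_prod_mul (hf 0).aemeasurable]
    · rfl
    · exact (Finset.measurable_prod _ fun i _ => (hf _).comp (measurable_pi_apply i)).aemeasurable

theorem lintegral_euc_prod (n : ℕ) (f : Fin n → ℝ → ℝ≥0∞) (hf : ∀ i, Measurable (f i)) :
    ∫⁻ x : Euc n, ∏ i, f i (x i) = ∏ i, ∫⁻ t, f i t := by
  rw [← lintegral_pi_prod n f hf]
  exact (PiLp.volume_preserving_ofLp (Fin n)).lintegral_comp
    (f := fun x : Fin n → ℝ => ∏ i, f i (x i))
    (Finset.measurable_prod _ fun i _ => (hf _).comp (measurable_pi_apply i))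

theorem erealExp_coe (r : ℝ) : erealExp (r : EReal) = ENNReal.ofReal (Real.exp r) := by
  simp [erealExp]

theorem erealExp_bot : erealExp ⊥ = 0 := by simp [erealExp]

def auxJ (c t : ℝ) : ℝ≥0∞ := if -1 ≤ t then ENNReal.ofReal (Real.exp (-(c * t))) else 0

theorem auxJ_meas (c : ℝ) : Measurable (auxJ c) :=
  Measurable.ite measurableSet_Ici (by fun_prop) measurable_const

theorem auxJ_pos (c : ℝ) (hc : 0 < c) : ∫⁻ t, auxJ c t = ENNReal.ofReal (Real.exp c / c) := by
  have h1 : auxJ c = (Set.Ici (-1)).indicator (fun t => ENNReal.ofReal (Real.exp (-c * t))) := by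
    ext t; simp [auxJ, Set.indicator]
  rw [h1, lintegral_indicator measurableSet_Ici, setLIntegral_congr Ioi_ae_eq_Ici.symm,
    ← ofReal_integral_eq_lintegral_ofReal (integrableOn_exp_mul_Ioi (by linarith) _)
      (ae_of_all _ fun _ => (Real.exp_pos _).le), integral_exp_mul_Ioi (by linarith)]
  congr 1
  rw [neg_mul_neg, mul_one, neg_div_neg_eq]

theorem auxJ_neg (c : ℝ) (hc : c ≤ 0) : ∫⁻ t, auxJ c t = ⊤ := by
  rw [eq_top_iff]
  calc (⊤ : ℝ≥0∞) = ∫⁻ t, (Set.Ici (0:ℝ)).indicator (fun _ => 1) t := by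
        rw [lintegral_indicator measurableSet_Ici]; simp
    _ ≤ _ := by
        apply lintegral_mono
        intro t
        by_cases ht : 0 ≤ t
        · have : -1 ≤ t := by linarith
          simp [auxJ, Set.indicator, ht, this]
          nlinarith
        · simp [Set.indicator, ht]

theorem auxJ_prod {n : ℕ} (c : Fin n → ℝ) (x : Euc n) :
    (∏ i, auxJ (c i) (x i)) =
      if ∀ i, (-1 : ℝ) ≤ x i then ENNReal.ofReal (Real.exp (-∑ i, c i * x i)) else 0 := by
  split_ifs with h
  · rw [← Finset.sum_neg_distrib, Real.exp_sum,
      ENNReal.ofReal_prod_of_nonneg (fun i _ => (Real.exp_pos _).le)]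
    exact Finset.prod_congr rfl fun i _ => by simp [auxJ, h i]
  · push Not at h
    obtain ⟨i, hi⟩ := h
    exact Finset.prod_eq_zero (Finset.mem_univ i) (by simp [auxJ, not_le.2 hi])

theorem volE_simplex (n : ℕ) : VolE (funcSimplex n) = ENNReal.ofReal (Real.exp n) := by
  have h : ∀ x : Euc n, erealExp (-(funcSimplex n x)) = ∏ i, auxJ ((fun _ => 1) i) (x i) := by
    intro x
    rw [auxJ_prod, funcSimplex]
    split_ifs with h
    · rw [← EReal.coe_neg, erealExp_coe]; simp
    · simp [erealExp_bot]
  simp only [VolE, h]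
  rw [lintegral_euc_prod n (fun _ => auxJ 1) (fun _ => auxJ_meas 1)]
  rw [auxJ_pos 1 one_pos, ← ENNReal.ofReal_prod_of_nonneg (fun i _ => by positivity)]
  simp [← Real.exp_nat_mul]

theorem lpIntE_simplex (n : ℕ) (p : ℝ) (hp : 0 < p) (y : Euc n) :
    LpIntE p (funcSimplex n) y = ∏ i, ∫⁻ t, auxJ (p + 1 - p * y i) t := by
  have h : ∀ x : Euc n, erealExp (((p * ⟪x, y⟫ : ℝ) : EReal) -
      ((p + 1 : ℝ) : EReal) * funcSimplex n x) = ∏ i, auxJ ((fun i => p + 1 - p * y i) i) (x i) := by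
    intro x
    rw [auxJ_prod, funcSimplex]
    split_ifs with h
    · rw [← EReal.coe_mul, ← EReal.coe_sub, erealExp_coe]
      congr 2
      simp only [PiLp.inner_apply, Finset.mul_sum, ← Finset.sum_sub_distrib,
        ← Finset.sum_neg_distrib]
      refine Finset.sum_congr rfl fun i _ => ?_
      simp; ring
    · rw [EReal.coe_mul_top_of_pos (by linarith), EReal.sub_top, erealExp_bot]
  simp only [LpIntE, h]
  rw [lintegral_euc_prod n (fun i => auxJ (p + 1 - p * y i)) (fun _ => auxJ_meas _)]

def auxG (p t : ℝ) : ℝ≥0∞ :=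
  if t < (p + 1) / p then ENNReal.ofReal (Real.exp (t - 1) * (p + 1 - p * t) ^ (1 / p)) else 0

theorem auxG_meas (p : ℝ) : Measurable (auxG p) :=
  Measurable.ite measurableSet_Iio (by fun_prop) measurable_const

theorem auxG_int (p : ℝ) (hp : 0 < p) : ∫⁻ t, auxG p t =
    ENNReal.ofReal (Real.exp (1 / p) * p ^ (1 / p) * Real.Gamma (1 + 1 / p)) := by
  rw [← lintegral_sub_left_eq_self (auxG p) ((p + 1) / p)]
  have h1 : (fun t => auxG p ((p + 1) / p - t)) = (Set.Ioi 0).indicator (fun t =>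
      ENNReal.ofReal (Real.exp (1 / p) * p ^ (1 / p) *
        (Real.exp (-t) * t ^ ((1 + 1 / p) - 1)))) := by
    ext t
    by_cases ht : 0 < t
    · simp only [auxG, Set.indicator, Set.mem_Ioi, ht, if_true, sub_lt_self_iff]
      congr 1
      have e1 : p + 1 - p * ((p + 1) / p - t) = p * t := by field_simp; ring
      have e2 : (p + 1) / p - t - 1 = 1 / p + -t := by field_simp; ring
      rw [e1, e2, Real.mul_rpow hp.le ht.le, Real.exp_add, add_sub_cancel_left]
      ring
    · simp [auxG, Set.indicator, ht]
  rw [h1, lintegral_indicator measurableSet_Ioi, ← ofReal_integral_eq_lintegral_ofReal,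
    integral_const_mul, ← Real.Gamma_eq_integral (by positivity)]
  · exact (Real.GammaIntegral_convergent (by positivity)).const_mul _
  · refine (ae_restrict_iff' measurableSet_Ioi).2 (ae_of_all _ fun t ht => ?_)
    have : (0:ℝ) < t := ht
    simp only [Pi.zero_apply]
    positivity

theorem lpStar_simplex (n : ℕ) (p : ℝ) (hp : 0 < p) (y : Euc n) :
    erealExp (-(LpStar p (funcSimplex n) y)) = ∏ i, auxG p (y i) := by
  have hiff : ∀ t : ℝ, t < (p + 1) / p ↔ 0 < p + 1 - p * t := by
    intro t
    rw [lt_div_iff₀ hp, sub_pos, mul_comm]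
  by_cases h : ∀ i, y i < (p + 1) / p
  · have hc : ∀ i, 0 < p + 1 - p * y i := fun i => (hiff _).1 (h i)
    have e : LpIntE p (funcSimplex n) y =
        ENNReal.ofReal (∏ i, Real.exp (p + 1 - p * y i) / (p + 1 - p * y i)) := by
      rw [lpIntE_simplex n p hp,
        ENNReal.ofReal_prod_of_nonneg (fun i _ => (div_pos (Real.exp_pos _) (hc i)).le)]
      exact Finset.prod_congr rfl fun i _ => auxJ_pos _ (hc i)
    have hP : 0 < ∏ i, Real.exp (p + 1 - p * y i) / (p + 1 - p * y i) :=
      Finset.prod_pos fun i _ => div_pos (Real.exp_pos _) (hc i)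
    have hr : ∏ i, auxG p (y i) = ENNReal.ofReal
        (∏ i, Real.exp (y i - 1) * (p + 1 - p * y i) ^ (1 / p)) := by
      rw [ENNReal.ofReal_prod_of_nonneg
        (fun i _ => (mul_pos (Real.exp_pos _) (Real.rpow_pos_of_pos (hc i) _)).le)]
      exact Finset.prod_congr rfl fun i _ => by simp only [auxG, h i, if_true]
    rw [LpStar, e, if_neg ENNReal.ofReal_ne_top, ← EReal.coe_neg, erealExp_coe, hr, Vol,
      volE_simplex, ENNReal.toReal_ofReal hP.le, ENNReal.toReal_ofReal (Real.exp_pos _).le]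
    congr 1
    have hn : (n : ℝ) = ∑ i : Fin n, (1 : ℝ) := by simp
    rw [Real.log_div hP.ne' (Real.exp_pos _).ne', Real.log_exp,
      Real.log_prod (fun i _ => (div_pos (Real.exp_pos _) (hc i)).ne'), hn,
      ← Finset.sum_sub_distrib, Finset.mul_sum, ← Finset.sum_neg_distrib, Real.exp_sum]
    refine Finset.prod_congr rfl fun i _ => ?_
    rw [Real.log_div (Real.exp_pos _).ne' (hc i).ne', Real.log_exp,
      Real.rpow_def_of_pos (hc i), ← Real.exp_add]
    congr 1
    field_simp
    ring
  · push Not at h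
    obtain ⟨i, hi⟩ := h
    have e : LpIntE p (funcSimplex n) y = ⊤ := by
      rw [lpIntE_simplex n p hp, ← Finset.mul_prod_erase _ _ (Finset.mem_univ i), auxJ_neg,
        ENNReal.top_mul]
      · refine Finset.prod_ne_zero_iff.2 fun j _ => ?_
        by_cases hj : 0 < p + 1 - p * y j
        · rw [auxJ_pos _ hj]
          exact (ENNReal.ofReal_pos.2 (div_pos (Real.exp_pos _) hj)).ne'
        · rw [auxJ_neg _ (not_lt.1 hj)]; simp
      · exact not_lt.1 fun h' => not_lt.2 hi ((hiff _).2 h')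
    rw [LpStar, if_pos e, EReal.neg_top, erealExp_bot]
    exact (Finset.prod_eq_zero (Finset.mem_univ i) (by simp [auxG, not_lt.2 hi])).symm

/-- the `L^p`-Mahler integral of the functional simplex:
`M_p(φ_{Δₙ}) = (e^{1+1/p} p^{1/p} Γ(1+1/p))ⁿ`. -/
theorem lp_mahler_funcSimplex (n : ℕ) (hn : 1 ≤ n) (p : ℝ) (hp : 0 < p) :
    MpE p (funcSimplex n) =
      ENNReal.ofReal ((Real.exp (1 + 1 / p) * p ^ (1 / p) * Real.Gamma (1 + 1 / p)) ^ n) := by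
  simp only [MpE, volE_simplex]
  rw [VolE]
  simp only [lpStar_simplex n p hp]
  rw [lintegral_euc_prod n (fun _ => auxG p) (fun _ => auxG_meas p), auxG_int p hp]
  have hG : 0 < Real.Gamma (1 + 1 / p) := Real.Gamma_pos_of_pos (by positivity)
  rw [Finset.prod_const, Finset.card_univ, Fintype.card_fin,
    ← ENNReal.ofReal_pow (by positivity), ← ENNReal.ofReal_mul (Real.exp_pos _).le]
  congr 1
  rw [show Real.exp n = Real.exp 1 ^ n by rw [← Real.exp_nat_mul, mul_one], ← mul_pow,
    Real.exp_add]
  ring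

end
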